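/- A linear map D : 𝔫 → 𝔫 satisfying D(𝔤_α) ⊆ 𝔤_α for every α ∈ R⁺ (say D(e_α) = a(α)e_α) is a derivation of 𝔫 if and only if a(α+β) = a(α) + a(β) whenever α, β, α+β ∈ R⁺; the space of all such weight-preserving derivations is n-dimensional with basis D₁,…,Dₙ; moreover, the only inner derivation of 𝔫 preserving every root space 𝔤_α is zero. -/

import Mathlib

open scoped InnerProductSpace

attribute [local instance 100] LieRing.ofAssociativeRing

/-- The combinatorial data attached to a simple finite-dimensional complex Lie algebra `𝔤`
of rank `n` with a fixed Cartan subalgebra and a fixed system of simple roots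
`α₁, …, αₙ`: a reduced crystallographic *irreducible* root system `R` in a euclidean
space `V`, together with a base `simple : Fin n → V` (the simple roots) and the coordinate
functions `coord`, recording for each positive root `α = Σᵢ Aᵢ(α) αᵢ` the tuple
`(A₁(α), …, Aₙ(α))` of its coordinates with respect to the simple roots. -/
structure RootSystemBase (n : ℕ) (V : Type*) [NormedAddCommGroup V]
    [InnerProductSpace ℝ V] : Type _ where
  /-- The (finite) set of roots. -/
  R : Finset V
  zero_not_mem : (0 : V) ∉ R
  span_eq_top : Submodule.span ℝ (R : Set V) = ⊤
  reduced : ∀ α ∈ R, ∀ c : ℝ, c • α ∈ R → c = 1 ∨ c = -1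
  crystallographic : ∀ α ∈ R, ∀ β ∈ R, ∃ k : ℤ, (k : ℝ) = 2 * ⟪β, α⟫_ℝ / ⟪α, α⟫_ℝ
  reflect_mem : ∀ α ∈ R, ∀ β ∈ R, β - (2 * ⟪β, α⟫_ℝ / ⟪α, α⟫_ℝ) • α ∈ R
  /-- irreducibility: `R` is not the union of two nonempty orthogonal subsets;
  equivalently `𝔤` is simple rather than merely semisimple. -/
  irreducible : ∀ S : Finset V, S ⊆ R → (∀ α ∈ S, ∀ β ∈ R, β ∉ S → ⟪α, β⟫_ℝ = 0) →
    S = ∅ ∨ S = R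
  /-- The simple roots `α₁, …, αₙ`. -/
  simple : Fin n → V
  simple_mem : ∀ i, simple i ∈ R
  simple_linearIndependent : LinearIndependent ℝ simple
  /-- `coord β i` is the coefficient `Aᵢ(β)` of `β` in the basis of simple roots. -/
  coord : V → Fin n → ℤ
  root_eq_sum : ∀ β ∈ R, β = ∑ i, (coord β i : ℝ) • simple i
  coord_sign : ∀ β ∈ R, (∀ i, 0 ≤ coord β i) ∨ (∀ i, coord β i ≤ 0)

namespace RootSystemBase

variable {n : ℕ} {V : Type*} [NormedAddCommGroup V] [InnerProductSpace ℝ V]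
variable (Φ : RootSystemBase n V)

/-- `β` is a positive root. -/
def IsPos (β : V) : Prop := β ∈ Φ.R ∧ ∀ i, 0 ≤ Φ.coord β i

/-- The level `l(β) = Σᵢ Aᵢ(β)` of a root `β`. -/
def level (β : V) : ℤ := ∑ i, Φ.coord β i

/-- `μ` is the highest root. -/
def IsHighest (μ : V) : Prop :=
  Φ.IsPos μ ∧ ∀ β, Φ.IsPos β → ∀ i, Φ.coord β i ≤ Φ.coord μ i

end RootSystemBase

/-- A linear map `T : 𝔫 → 𝔫` is a derivation of the Lie algebra `𝔫`. -/
def IsLieDerivation {L : Type*} [LieRing L] [LieAlgebra ℂ L] (T : Module.End ℂ L) : Prop :=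
  ∀ x y : L, T ⁅x, y⁆ = ⁅T x, y⁆ + ⁅x, T y⁆

/-- The inner derivations `ad x`, `x ∈ 𝔫`, as a subspace of `End(𝔫)`. -/
noncomputable def innerDerivations (L : Type*) [LieRing L] [LieAlgebra ℂ L] :
    Submodule ℂ (Module.End ℂ L) :=
  LinearMap.range (LieAlgebra.ad ℂ L).toLinearMap

/-- The derivations of `𝔫`, as a subspace of `End(𝔫)`. -/
noncomputable def derivations (L : Type*) [LieRing L] [LieAlgebra ℂ L] :
    Submodule ℂ (Module.End ℂ L) where
  carrier := {T | IsLieDerivation T}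
  add_mem' := by
    intro S T hS hT x y
    simp only [LinearMap.add_apply, hS x y, hT x y, add_lie, lie_add]
    abel
  zero_mem' := by intro x y; simp
  smul_mem' := by
    intro c T hT x y
    simp only [LinearMap.smul_apply, hT x y, smul_lie, lie_smul, smul_add]

/-- A Chevalley-basis presentation of the maximal nilpotent subalgebra
`𝔫 = ⊕_{α ∈ R⁺} 𝔤_α` of a simple finite-dimensional complex Lie algebra `𝔤` with root
system `Φ`: a complex Lie algebra `𝔫` together with a basis `e` of root vectors indexed
by the positive roots, such that `⁅e_α, e_β⁆ = N_{αβ} • e_{α+β}` when `α+β ∈ R⁺` and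
`⁅e_α, e_β⁆ = 0` otherwise, where the structure constants `N_{αβ}` of the Chevalley basis
are nonzero whenever `α + β` is a root. -/
structure ChevalleyNilradical {n : ℕ} {V : Type*} [NormedAddCommGroup V]
    [InnerProductSpace ℝ V] (Φ : RootSystemBase n V)
    (L : Type*) [LieRing L] [LieAlgebra ℂ L] where
  /-- the root vectors `e_α`, `α ∈ R⁺`, a basis of `𝔫` -/
  e : Module.Basis {β : V // Φ.IsPos β} ℂ L
  /-- the structure constants -/
  N : V → V → ℂ
  lie_eq : ∀ (α β : {β : V // Φ.IsPos β}) (h : Φ.IsPos (α.1 + β.1)),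
    ⁅e α, e β⁆ = N α.1 β.1 • e ⟨α.1 + β.1, h⟩
  lie_eq_zero : ∀ α β : {β : V // Φ.IsPos β}, ¬ Φ.IsPos (α.1 + β.1) → ⁅e α, e β⁆ = 0
  N_ne_zero : ∀ α β : {β : V // Φ.IsPos β}, Φ.IsPos (α.1 + β.1) → N α.1 β.1 ≠ 0

namespace ChevalleyNilradical

variable {n : ℕ} {V : Type*} [NormedAddCommGroup V] [InnerProductSpace ℝ V]
  {Φ : RootSystemBase n V} {L : Type*} [LieRing L] [LieAlgebra ℂ L]
  (C : ChevalleyNilradical Φ L)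

/-- The weight-zero cocycle (derivation) `Dᵢ = cᵢ : e_α ↦ Aᵢ(α) e_α`. -/
noncomputable def D (i : Fin n) : Module.End ℂ L :=
  C.e.constr ℂ fun β => (Φ.coord β.1 i : ℂ) • C.e β

/-- The cocycle (derivation) `Bᵢ = bᵢ = e_{γᵢ} ⊗ f^{αᵢ}`, sending `e_{αᵢ} ↦ e_{γᵢ}` where
`γᵢ = μ − mᵢ αᵢ`, and killing `e_β` for every positive root `β ≠ αᵢ`. -/
noncomputable def B (μ : V) (m : Fin n → ℕ)
    (hγ : ∀ i, Φ.IsPos (μ - m i • Φ.simple i)) (i : Fin n) : Module.End ℂ L :=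
  letI := Classical.decEq V
  C.e.constr ℂ fun β => if β.1 = Φ.simple i then C.e ⟨μ - m i • Φ.simple i, hγ i⟩ else 0

end ChevalleyNilradical

namespace RootSystemBase

variable {n : ℕ} {V : Type*} [NormedAddCommGroup V] [InnerProductSpace ℝ V]
variable (Φ : RootSystemBase n V)

theorem coord_eq_of_eq_sum {β : V} (hβ : β ∈ Φ.R) (c : Fin n → ℤ)
    (h : β = ∑ i, (c i : ℝ) • Φ.simple i) : Φ.coord β = c := by
  funext i
  have hli := Fintype.linearIndependent_iff.mp Φ.simple_linearIndependent
    (fun i => (Φ.coord β i : ℝ) - c i) (by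
      simp only [sub_smul, Finset.sum_sub_distrib]
      rw [← Φ.root_eq_sum β hβ, ← h, sub_self]) i
  exact_mod_cast sub_eq_zero.mp hli

theorem coord_simple (i : Fin n) : Φ.coord (Φ.simple i) = Pi.single i 1 := by
  apply Φ.coord_eq_of_eq_sum (Φ.simple_mem i)
  rw [Finset.sum_eq_single i] <;> simp +contextual

theorem isPos_simple (i : Fin n) : Φ.IsPos (Φ.simple i) := by
  refine ⟨Φ.simple_mem i, fun j => ?_⟩
  rw [Φ.coord_simple, Pi.single_apply]
  split_ifs <;> norm_num

theorem coord_add {α β : V} (hα : α ∈ Φ.R) (hβ : β ∈ Φ.R) (h : α + β ∈ Φ.R) :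
    Φ.coord (α + β) = Φ.coord α + Φ.coord β := by
  apply Φ.coord_eq_of_eq_sum h
  simp only [Pi.add_apply, Int.cast_add, add_smul, Finset.sum_add_distrib]
  rw [← Φ.root_eq_sum α hα, ← Φ.root_eq_sum β hβ]

theorem ne_zero_of_mem {α : V} (hα : α ∈ Φ.R) : α ≠ 0 :=
  fun h => Φ.zero_not_mem (h ▸ hα)

theorem inner_self_pos {α : V} (hα : α ∈ Φ.R) : 0 < ⟪α, α⟫_ℝ :=
  real_inner_self_pos.mpr (Φ.ne_zero_of_mem hα)

theorem neg_mem {α : V} (hα : α ∈ Φ.R) : -α ∈ Φ.R := by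
  have h := Φ.reflect_mem α hα α hα
  rw [mul_div_assoc, div_self (Φ.inner_self_pos hα).ne', mul_one, two_smul] at h
  simpa using h

theorem sub_mem_of_inner_pos {α β : V} (hα : α ∈ Φ.R) (hβ : β ∈ Φ.R) (hne : β ≠ α)
    (h : 0 < ⟪β, α⟫_ℝ) : β - α ∈ Φ.R := by
  have hαα := Φ.inner_self_pos hα
  have hββ := Φ.inner_self_pos hβ
  have hsymm : ⟪α, β⟫_ℝ = ⟪β, α⟫_ℝ := real_inner_comm _ _
  obtain ⟨k, hk⟩ := Φ.crystallographic α hα β hβ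
  obtain ⟨l, hl⟩ := Φ.crystallographic β hβ α hα
  have hk0 : 0 < k := by
    have : (0 : ℝ) < k := by rw [hk]; positivity
    exact_mod_cast this
  have hl0 : 0 < l := by
    have : (0 : ℝ) < l := by rw [hl, hsymm]; positivity
    exact_mod_cast this
  have hrk := Φ.reflect_mem α hα β hβ
  have hrl := Φ.reflect_mem β hβ α hα
  rw [← hk] at hrk
  rw [← hl] at hrl
  rcases eq_or_lt_of_le (Int.add_one_le_of_lt hk0) with hk1 | hk2
  · rw [← hk1] at hrk
    simpa using hrk
  rcases eq_or_lt_of_le (Int.add_one_le_of_lt hl0) with hl1 | hl2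
  · rw [← hl1] at hrl
    simpa using Φ.neg_mem hrl
  have hk2' : (2 : ℝ) ≤ k := by exact_mod_cast hk2
  have hl2' : (2 : ℝ) ≤ l := by exact_mod_cast hl2
  rw [hk, le_div_iff₀ hαα] at hk2'
  rw [hl, le_div_iff₀ hββ] at hl2'
  refine absurd (sub_eq_zero.mp (real_inner_self_nonpos.mp ?_)) hne
  rw [real_inner_sub_sub_self]
  linarith

theorem IsPos.exists_eq_simple_or_isPos_sub {β : V} (hβ : Φ.IsPos β) :
    ∃ i, β = Φ.simple i ∨ Φ.IsPos (β - Φ.simple i) := by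
  have hsum : ⟪β, β⟫_ℝ = ∑ i, (Φ.coord β i : ℝ) * ⟪β, Φ.simple i⟫_ℝ := by
    conv_lhs => enter [3]; rw [Φ.root_eq_sum β hβ.1]
    simp_rw [inner_sum, real_inner_smul_right]
  obtain ⟨i, hi⟩ : ∃ i, 0 < (Φ.coord β i : ℝ) * ⟪β, Φ.simple i⟫_ℝ := by
    by_contra! h
    exact (Φ.inner_self_pos hβ.1).not_ge (hsum ▸ Finset.sum_nonpos fun i _ => h i)
  have hci : (0 : ℝ) ≤ Φ.coord β i := by exact_mod_cast hβ.2 i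
  have hin : 0 < ⟪β, Φ.simple i⟫_ℝ := pos_of_mul_pos_right hi hci
  refine ⟨i, or_iff_not_imp_left.mpr fun hne => ?_⟩
  have hmem := Φ.sub_mem_of_inner_pos (Φ.simple_mem i) hβ.1 hne hin
  have hcoord := Φ.coord_add hmem (Φ.simple_mem i) (by simpa using hβ.1)
  rw [sub_add_cancel, Φ.coord_simple] at hcoord
  refine ⟨hmem, (Φ.coord_sign _ hmem).resolve_right fun hneg => hne ?_⟩
  have hzero : ∀ j, j ≠ i → Φ.coord β j = 0 := fun j hj => by
    refine le_antisymm ?_ (hβ.2 j)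
    simpa [hcoord, hj] using hneg j
  have hβi : β = (Φ.coord β i : ℝ) • Φ.simple i := by
    conv_lhs => rw [Φ.root_eq_sum β hβ.1]
    exact Finset.sum_eq_single i (fun j _ hj => by simp [hzero j hj]) (by simp)
  rcases Φ.reduced _ (Φ.simple_mem i) _ (hβi ▸ hβ.1) with h | h
  · rwa [h, one_smul] at hβi
  · linarith

theorem IsPos.induction {P : V → Prop} (base : ∀ i, P (Φ.simple i))
    (step : ∀ α i, Φ.IsPos α → Φ.IsPos (α + Φ.simple i) → P α → P (α + Φ.simple i))
    {β : V} (hβ : Φ.IsPos β) : P β := by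
  obtain ⟨m, hm⟩ : ∃ m : ℕ, (m : ℤ) = Φ.level β :=
    Int.eq_ofNat_of_zero_le (Finset.sum_nonneg fun i _ => hβ.2 i) |>.imp fun _ h => h.symm
  induction m generalizing β with
  | zero =>
    have hz := (Finset.sum_eq_zero_iff_of_nonneg fun i _ => hβ.2 i).mp hm.symm
    refine absurd ?_ (Φ.ne_zero_of_mem hβ.1)
    rw [Φ.root_eq_sum β hβ.1]
    exact Finset.sum_eq_zero fun i hi => by simp [hz i hi]
  | succ m ih =>
    obtain ⟨i, rfl | hi⟩ := hβ.exists_eq_simple_or_isPos_sub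
    · exact base i
    · have hstep := step _ i hi (by simpa using hβ)
      rw [sub_add_cancel] at hstep
      refine hstep (ih hi ?_)
      have hcoord := Φ.coord_add hi.1 (Φ.simple_mem i) (by simpa using hβ.1)
      rw [sub_add_cancel, Φ.coord_simple] at hcoord
      simpa [level, hcoord, Finset.sum_add_distrib] using hm

end RootSystemBase

theorem isLieDerivation_of_basis {L ι : Type*} [LieRing L] [LieAlgebra ℂ L]
    (b : Module.Basis ι ℂ L) {T : Module.End ℂ L}
    (h : ∀ i j, T ⁅b i, b j⁆ = ⁅T (b i), b j⁆ + ⁅b i, T (b j)⁆) : IsLieDerivation T := by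
  let ad : L →ₗ[ℂ] Module.End ℂ L := (LieAlgebra.ad ℂ L).toLinearMap
  have key : ad.compr₂ T = ad.comp T + ad.compl₂ T :=
    b.ext fun i => b.ext fun j => by simpa [ad] using h i j
  intro x y
  simpa [ad] using LinearMap.congr_fun₂ key x y

namespace ChevalleyNilradical

variable {n : ℕ} {V : Type*} [NormedAddCommGroup V] [InnerProductSpace ℝ V]
  {Φ : RootSystemBase n V} {L : Type*} [LieRing L] [LieAlgebra ℂ L]
  (C : ChevalleyNilradical Φ L)

theorem isLieDerivation_iff {T : Module.End ℂ L} {a : V → ℂ}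
    (hT : ∀ β : {β : V // Φ.IsPos β}, T (C.e β) = a β.1 • C.e β) :
    IsLieDerivation T ↔
      ∀ α β : V, Φ.IsPos α → Φ.IsPos β → Φ.IsPos (α + β) → a (α + β) = a α + a β := by
  constructor
  · intro h α β hα hβ hαβ
    have h1 := h (C.e ⟨α, hα⟩) (C.e ⟨β, hβ⟩)
    rw [hT, hT, smul_lie, lie_smul, C.lie_eq ⟨α, hα⟩ ⟨β, hβ⟩ hαβ, map_smul, hT, ← add_smul,
      smul_comm] at h1
    exact smul_left_injective ℂ
      (smul_ne_zero (C.N_ne_zero ⟨α, hα⟩ ⟨β, hβ⟩ hαβ) (C.e.ne_zero _)) h1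
  · intro h
    refine isLieDerivation_of_basis C.e fun α β => ?_
    rw [hT, hT, smul_lie, lie_smul, ← add_smul]
    by_cases hαβ : Φ.IsPos (α.1 + β.1)
    · rw [C.lie_eq α β hαβ, map_smul, hT, h _ _ α.2 β.2 hαβ, smul_comm]
    · rw [C.lie_eq_zero α β hαβ, map_zero, smul_zero]

theorem D_apply_e (i : Fin n) (β : {β : V // Φ.IsPos β}) :
    C.D i (C.e β) = (Φ.coord β.1 i : ℂ) • C.e β :=
  C.e.constr_basis ℂ _ β

theorem isLieDerivation_D (i : Fin n) : IsLieDerivation (C.D i) := by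
  refine (C.isLieDerivation_iff (a := fun β => (Φ.coord β i : ℂ)) (C.D_apply_e i)).mpr
    fun α β hα hβ hαβ => ?_
  simp [Φ.coord_add hα.1 hβ.1 hαβ.1]

theorem sum_smul_D_apply_e (c : Fin n → ℂ) (β : {β : V // Φ.IsPos β}) :
    (∑ i, c i • C.D i) (C.e β) = (∑ i, c i * (Φ.coord β.1 i : ℂ)) • C.e β := by
  simp [LinearMap.sum_apply, D_apply_e, Finset.sum_smul, smul_smul]

theorem linearIndependent_D : LinearIndependent ℂ C.D := by
  refine Fintype.linearIndependent_iff.mpr fun c hc i => ?_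
  have h := C.sum_smul_D_apply_e c ⟨Φ.simple i, Φ.isPos_simple i⟩
  rw [hc, LinearMap.zero_apply, eq_comm, smul_eq_zero_iff_left (C.e.ne_zero _)] at h
  simpa [Φ.coord_simple, Pi.single_apply] using h

theorem mem_span_D {T : Module.End ℂ L} (hT : IsLieDerivation T)
    (hw : ∀ β : {β : V // Φ.IsPos β}, ∃ c : ℂ, T (C.e β) = c • C.e β) :
    T ∈ Submodule.span ℂ (Set.range C.D) := by
  classical
  choose c hc using hw
  let a : V → ℂ := fun v => if h : Φ.IsPos v then c ⟨v, h⟩ else 0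
  have ha : ∀ β : {β : V // Φ.IsPos β}, T (C.e β) = a β.1 • C.e β := fun β => by
    simp [a, β.2, hc]
  have hadd := (C.isLieDerivation_iff ha).mp hT
  have hlin : ∀ β, Φ.IsPos β → a β = ∑ i, a (Φ.simple i) * (Φ.coord β i : ℂ) := by
    intro β hβ
    refine RootSystemBase.IsPos.induction Φ
      (P := fun β => a β = ∑ i, a (Φ.simple i) * (Φ.coord β i : ℂ))
      (fun i => ?_) (fun α i hα hαi ih => ?_) hβ
    · simp [Φ.coord_simple, Pi.single_apply]
    · rw [hadd _ _ hα (Φ.isPos_simple i) hαi, ih,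
        Φ.coord_add hα.1 (Φ.simple_mem i) hαi.1, Φ.coord_simple]
      simp [mul_add, Finset.sum_add_distrib, Pi.single_apply]
  have hsum : T = ∑ i, a (Φ.simple i) • C.D i := C.e.ext fun β => by
    rw [ha, C.sum_smul_D_apply_e, hlin _ β.2]
  rw [hsum]
  exact Submodule.sum_mem _ fun i _ =>
    Submodule.smul_mem _ _ (Submodule.subset_span ⟨i, rfl⟩)

theorem repr_lie_e_self (x : L) (β : {β : V // Φ.IsPos β}) : C.e.repr ⁅x, C.e β⁆ β = 0 := by
  have key : C.e.coord β ∘ₗ (LieAlgebra.ad ℂ L).toLinearMap.flip (C.e β) = 0 := by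
    refine C.e.ext fun α => ?_
    by_cases h : Φ.IsPos (α.1 + β.1)
    · have hne : (⟨α.1 + β.1, h⟩ : {β : V // Φ.IsPos β}) ≠ β := fun he =>
        Φ.ne_zero_of_mem α.2.1 (add_eq_right.mp (congrArg Subtype.val he))
      simp [C.lie_eq α β h, hne]
    · simp [C.lie_eq_zero α β h]
  simpa using LinearMap.congr_fun key x

theorem ad_eq_zero {x : L}
    (hx : ∀ β : {β : V // Φ.IsPos β}, ∃ c : ℂ, LieAlgebra.ad ℂ L x (C.e β) = c • C.e β) :
    LieAlgebra.ad ℂ L x = 0 := by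
  refine C.e.ext fun β => ?_
  obtain ⟨c, hc⟩ := hx β
  have h := C.repr_lie_e_self x β
  rw [← LieAlgebra.ad_apply (R := ℂ), hc] at h
  have hc0 : c = 0 := by simpa using h
  rw [hc, hc0, zero_smul, LinearMap.zero_apply]

end ChevalleyNilradical

/-- A linear map `D : 𝔫 → 𝔫` satisfying `D(𝔤_α) ⊆ 𝔤_α` for every
`α ∈ R⁺` (say `D(e_α) = a(α) e_α`) is a derivation of `𝔫` if and only if
`a(α+β) = a(α) + a(β)` whenever `α, β, α+β ∈ R⁺`; the space of all such
weight-preserving derivations is `n`-dimensional with basis `D₁, …, Dₙ`; moreover the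
only inner derivation of `𝔫` preserving every root space `𝔤_α` is zero. -/
theorem weight_preserving_derivations
    {n : ℕ} {V : Type*} [NormedAddCommGroup V] [InnerProductSpace ℝ V]
    (Φ : RootSystemBase n V) (L : Type*) [LieRing L] [LieAlgebra ℂ L]
    (C : ChevalleyNilradical Φ L) :
    -- the derivation criterion
    (∀ (T : Module.End ℂ L) (a : V → ℂ),
      (∀ β : {β : V // Φ.IsPos β}, T (C.e β) = a β.1 • C.e β) →
      (IsLieDerivation T ↔
        ∀ α β : V, Φ.IsPos α → Φ.IsPos β → Φ.IsPos (α + β) → a (α + β) = a α + a β)) ∧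
    -- each `Dᵢ` is a weight-preserving derivation
    (∀ i : Fin n, IsLieDerivation (C.D i) ∧
      ∀ β : {β : V // Φ.IsPos β}, ∃ c : ℂ, C.D i (C.e β) = c • C.e β) ∧
    -- `D₁, …, Dₙ` are linearly independent and span the space of
    -- weight-preserving derivations
    LinearIndependent ℂ C.D ∧
    (∀ T : Module.End ℂ L, IsLieDerivation T →
      (∀ β : {β : V // Φ.IsPos β}, ∃ c : ℂ, T (C.e β) = c • C.e β) →
      T ∈ Submodule.span ℂ (Set.range C.D)) ∧
    -- the only inner derivation preserving all root spaces is zero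
    (∀ x : L, (∀ β : {β : V // Φ.IsPos β}, ∃ c : ℂ,
        LieAlgebra.ad ℂ L x (C.e β) = c • C.e β) →
      LieAlgebra.ad ℂ L x = 0) := by
  exact ⟨fun _ _ hT => C.isLieDerivation_iff hT,
    fun i => ⟨C.isLieDerivation_D i, fun β => ⟨_, C.D_apply_e i β⟩⟩,
    C.linearIndependent_D, fun _ => C.mem_span_D, fun _ => C.ad_eq_zero⟩
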